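/- arXiv:1209.2968 — 4 statements merged into one kernel-verified Lean document; each statement's English description precedes it below -/
import Mathlib

section
/- Let X be a compact metric space, let μ₁ and μ₂ be finite Borel measures on X, and let V ⊆ X be a Borel set with μ₁(V) > 0. Suppose that for every continuous function a : X → ℝ, ∫_V a dμ₁ = 0 implies ∫_V a dμ₂ = 0. Then the restriction of μ₂ to V is a nonnegative constant multiple of the restriction of μ₁ to V; explicitly, μ₂.restrict V = (μ₂(V)/μ₁(V)) • μ₁.restrict V. -/
open MeasureTheory

/-- Abstract form of Lemma 3.1: if every continuous function whose `μ₁`-integral over `V`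
vanishes also has vanishing `μ₂`-integral over `V`, then `μ₂` restricted to `V` is a
(nonnegative) constant multiple of `μ₁` restricted to `V`. -/
theorem restrict_eq_smul_restrict_of_integral_vanish
    {X : Type*} [MetricSpace X] [CompactSpace X] [MeasurableSpace X] [BorelSpace X]
    (μ₁ μ₂ : Measure X) [IsFiniteMeasure μ₁] [IsFiniteMeasure μ₂]
    (V : Set X) (hV : MeasurableSet V) (hpos : 0 < μ₁ V)
    (h : ∀ a : X → ℝ, Continuous a →
      (∫ x in V, a x ∂μ₁) = 0 → (∫ x in V, a x ∂μ₂) = 0) :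
    μ₂.restrict V = (μ₂ V / μ₁ V) • μ₁.restrict V := by
  have hne : μ₁ V ≠ 0 := hpos.ne'
  have hc : μ₂ V / μ₁ V ≠ ⊤ := ENNReal.div_ne_top (measure_ne_top μ₂ V) hne
  have hfin : IsFiniteMeasure ((μ₂ V / μ₁ V) • μ₁.restrict V) :=
    Measure.smul_finite _ hc
  have hr : (μ₁ V).toReal ≠ 0 := (ENNReal.toReal_pos hne (measure_ne_top μ₁ V)).ne'
  apply ext_of_forall_integral_eq_of_IsFiniteMeasure
  intro f
  have i1 : Integrable (fun x => f x) (μ₁.restrict V) := f.integrable _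
  have i2 : Integrable (fun x => f x) (μ₂.restrict V) := f.integrable _
  rw [integral_smul_measure, ENNReal.toReal_div, smul_eq_mul]
  have key := h (fun x => f x - (∫ y in V, f y ∂μ₁) / (μ₁ V).toReal)
    (f.continuous.sub continuous_const) (by
      rw [integral_sub i1 (integrable_const _), setIntegral_const, smul_eq_mul,
        Measure.real]
      field_simp
      ring)
  rw [integral_sub i2 (integrable_const _), setIntegral_const, smul_eq_mul,
    Measure.real] at key
  rw [sub_eq_zero.mp key]
  ring
end

section
/- Let H be a complex Hilbert space, P a bounded self-adjoint operator on H, A a bounded linear operator on H, E ∈ ℝ, T > 0, and ψ ∈ H with ‖ψ‖ = 1. Define the time average ⟨A⟩_T = (1/T)∫₀^T exp(itP) A exp(−itP) dt (Bochner integral in the space of bounded operators). Then |⟨⟨A⟩_T ψ, ψ⟩ − ⟨Aψ, ψ⟩| ≤ ‖A‖ · (T‖Pψ − Eψ‖) · (2 + T‖Pψ − Eψ‖). -/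
open Complex NormedSpace MeasureTheory
open scoped InnerProductSpace

lemma aux_star {H : Type*} [NormedAddCommGroup H] [InnerProductSpace ℂ H] [CompleteSpace H]
    (P : H →L[ℂ] H) (hP : IsSelfAdjoint P) (t : ℝ) :
    star (exp ((-(Complex.I * t)) • P)) = exp ((Complex.I * t) • P) := by
  rw [NormedSpace.star_exp, star_smul, hP.star_eq]
  congr 2
  simp

lemma aux_norm {H : Type*} [NormedAddCommGroup H] [InnerProductSpace ℂ H] [CompleteSpace H]
    (P : H →L[ℂ] H) (hP : IsSelfAdjoint P) (t : ℝ) (v : H) :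
    ‖exp ((-(Complex.I * t)) • P) v‖ = ‖v‖ := by
  have h1 : exp ((Complex.I * t) • P) * exp ((-(Complex.I * t)) • P) = 1 := by
    letI : NormedAlgebra ℚ (H →L[ℂ] H) := NormedAlgebra.restrictScalars ℚ ℂ (H →L[ℂ] H)
    rw [neg_smul, ← NormedSpace.exp_add_of_commute (Commute.neg_right (Commute.refl _))]
    simp
  have h2 : ⟪exp ((-(Complex.I * t)) • P) v, exp ((-(Complex.I * t)) • P) v⟫_ℂ = ⟪v, v⟫_ℂ := by
    rw [← ContinuousLinearMap.adjoint_inner_left, ← ContinuousLinearMap.star_eq_adjoint,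
      aux_star P hP, ← mul_apply_eq_comp, h1]
    simp
  rw [inner_self_eq_norm_sq_to_K, inner_self_eq_norm_sq_to_K] at h2
  have h3 : ‖exp ((-(Complex.I * t)) • P) v‖ ^ 2 = ‖v‖ ^ 2 := by exact_mod_cast h2
  exact (sq_eq_sq₀ (norm_nonneg _) (norm_nonneg _)).1 h3

lemma aux_duhamel {H : Type*} [NormedAddCommGroup H] [InnerProductSpace ℂ H] [CompleteSpace H]
    (P : H →L[ℂ] H) (hP : IsSelfAdjoint P) (E : ℝ) (ψ : H) (t : ℝ) (ht : 0 ≤ t) :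
    ‖Complex.exp (Complex.I * t * E) • exp ((-(Complex.I * t)) • P) ψ - ψ‖
      ≤ t * ‖P ψ - (E : ℂ) • ψ‖ := by
  have hU : ∀ s : ℝ, HasDerivAt (fun s : ℝ => exp ((-(Complex.I * s)) • P) ψ)
      (exp ((-(Complex.I * s)) • P) ((-Complex.I) • P ψ)) s := by
    intro s
    have h := hasDerivAt_exp_smul_const (𝕂 := ℝ) ((-Complex.I) • P) s
    have h2 := (((ContinuousLinearMap.apply ℂ H ψ).restrictScalars ℝ).hasFDerivAt).comp_hasDerivAt s h
    have e : ∀ s : ℝ, s • ((-Complex.I) • P) = (-(Complex.I * s)) • P := by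
      intro s
      rw [← Complex.coe_smul, smul_smul]
      congr 1
      ring
    simp only [Function.comp_def, e] at h2
    simpa using h2
  have hE : ∀ s : ℝ, HasDerivAt (fun s : ℝ => Complex.exp (Complex.I * s * E))
      (Complex.exp (Complex.I * s * E) * (Complex.I * E)) s := by
    intro s
    have h : HasDerivAt (fun s : ℝ => Complex.I * (s : ℂ) * E) (Complex.I * 1 * E) s :=
      ((Complex.ofRealCLM.hasDerivAt (x := s)).const_mul Complex.I).mul_const (E : ℂ)
    simpa using h.cexp
  have hf := fun s : ℝ => (hE s).smul (hU s)
  have key := norm_image_sub_le_of_norm_deriv_le_segment' (a := 0) (b := t)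
    (C := ‖P ψ - (E : ℂ) • ψ‖) (fun s _ => (hf s).hasDerivWithinAt) (by
      intro s _
      have : Complex.exp (Complex.I * s * E) • exp ((-(Complex.I * s)) • P) ((-Complex.I) • P ψ)
          + (Complex.exp (Complex.I * s * E) * (Complex.I * E)) • exp ((-(Complex.I * s)) • P) ψ
          = (Complex.exp (Complex.I * s * E) * (-Complex.I)) •
            exp ((-(Complex.I * s)) • P) (P ψ - (E : ℂ) • ψ) := by
        simp only [map_smul, map_sub]
        module
      rw [this, norm_smul, aux_norm P hP]
      have h1 : ‖Complex.exp (Complex.I * s * E)‖ = 1 := by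
        rw [Complex.norm_exp]; simp
      simp [h1]) t ⟨ht, le_rfl⟩
  simpa [mul_comm] using key

lemma aux_point {H : Type*} [NormedAddCommGroup H] [InnerProductSpace ℂ H] [CompleteSpace H]
    (P : H →L[ℂ] H) (hP : IsSelfAdjoint P) (A : H →L[ℂ] H) (E : ℝ) (ψ : H) (hψ : ‖ψ‖ = 1)
    (t : ℝ) (ht : 0 ≤ t) :
    ‖⟪ψ, ((exp ((Complex.I * t) • P)).comp
            (A.comp (exp ((-(Complex.I * t)) • P)))) ψ⟫_ℂ - ⟪ψ, A ψ⟫_ℂ‖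
      ≤ ‖A‖ * (t * ‖P ψ - (E : ℂ) • ψ‖) * 2 := by
  have hd := aux_duhamel P hP E ψ t ht
  have h1 : ‖Complex.exp (Complex.I * t * E)‖ = 1 := by
    rw [Complex.norm_exp]; simp
  have hn : ‖Complex.exp (Complex.I * t * E) • exp ((-(Complex.I * t)) • P) ψ‖ = 1 := by
    rw [norm_smul, h1, aux_norm P hP, hψ, one_mul]
  have e : ⟪ψ, ((exp ((Complex.I * t) • P)).comp
            (A.comp (exp ((-(Complex.I * t)) • P)))) ψ⟫_ℂ
      = ⟪Complex.exp (Complex.I * t * E) • exp ((-(Complex.I * t)) • P) ψ,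
          A (Complex.exp (Complex.I * t * E) • exp ((-(Complex.I * t)) • P) ψ)⟫_ℂ := by
    rw [map_smul, inner_smul_left, inner_smul_right, ← mul_assoc, Complex.conj_mul', h1,
      ← aux_star P hP, ContinuousLinearMap.star_eq_adjoint, ContinuousLinearMap.comp_apply,
      ContinuousLinearMap.adjoint_inner_right]
    simp
  rw [e]
  generalize Complex.exp (Complex.I * t * E) • exp ((-(Complex.I * t)) • P) ψ = f at hd hn
  have e2 : ⟪f, A f⟫_ℂ - ⟪ψ, A ψ⟫_ℂ = ⟪f, A (f - ψ)⟫_ℂ + ⟪f - ψ, A ψ⟫_ℂ := by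
    rw [map_sub, inner_sub_right, inner_sub_left]; ring
  rw [e2]
  have b1 : ‖⟪f, A (f - ψ)⟫_ℂ‖ ≤ ‖A‖ * ‖f - ψ‖ := by
    have := norm_inner_le_norm (𝕜 := ℂ) f (A (f - ψ))
    rw [hn, one_mul] at this
    exact this.trans (A.le_opNorm _)
  have b2 : ‖⟪f - ψ, A ψ⟫_ℂ‖ ≤ ‖A‖ * ‖f - ψ‖ := by
    have h := norm_inner_le_norm (𝕜 := ℂ) (f - ψ) (A ψ)
    have h' := A.le_opNorm ψ
    rw [hψ, mul_one] at h'
    rw [mul_comm]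
    exact h.trans (by gcongr)
  have b3 := mul_le_mul_of_nonneg_left hd (norm_nonneg A)
  have b4 := norm_add_le ⟪f, A (f - ψ)⟫_ℂ ⟪f - ψ, A ψ⟫_ℂ
  linarith

/-- Replacing a matrix element of `A` in a quasimode `ψ` by the matrix element of the
time average `⟨A⟩_T = (1/T)∫₀ᵀ e^{itP} A e^{-itP} dt`, with error controlled by the
quasimode residual `‖Pψ - Eψ‖`. -/
theorem abs_inner_timeAverage_sub_inner_le
    {H : Type*} [NormedAddCommGroup H] [InnerProductSpace ℂ H] [CompleteSpace H]
    (P : H →L[ℂ] H) (hP : IsSelfAdjoint P) (A : H →L[ℂ] H) (E : ℝ) (T : ℝ) (hT : 0 < T)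
    (ψ : H) (hψ : ‖ψ‖ = 1) :
    ‖⟪((1 / T) • ∫ t in (0:ℝ)..T,
          (exp ((Complex.I * t) • P)).comp
            (A.comp (exp ((-(Complex.I * t)) • P)))) ψ, ψ⟫_ℂ
        - ⟪A ψ, ψ⟫_ℂ‖
      ≤ ‖A‖ * (T * ‖P ψ - (E : ℂ) • ψ‖) * (2 + T * ‖P ψ - (E : ℂ) • ψ‖) := by
  set δ := ‖P ψ - (E : ℂ) • ψ‖ with hδ
  have hδ0 : 0 ≤ δ := norm_nonneg _
  set F : ℝ → (H →L[ℂ] H) := fun t => (exp ((Complex.I * t) • P)).comp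
            (A.comp (exp ((-(Complex.I * t)) • P))) with hF
  have hexp : Continuous (exp : (H →L[ℂ] H) → (H →L[ℂ] H)) := by
    letI : NormedAlgebra ℚ (H →L[ℂ] H) := NormedAlgebra.restrictScalars ℚ ℂ (H →L[ℂ] H)
    exact NormedSpace.exp_continuous
  have hFc : Continuous F := by
    apply Continuous.clm_comp
    · exact hexp.comp (by fun_prop)
    · exact continuous_const.clm_comp (hexp.comp (by fun_prop))
  let L : (H →L[ℂ] H) →L[ℂ] ℂ := (innerSL ℂ ψ).comp (ContinuousLinearMap.apply ℂ H ψ)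
  have hL : ∀ B, L B = ⟪ψ, B ψ⟫_ℂ := fun B => rfl
  have hLF : Continuous fun t => L (F t) := L.continuous.comp hFc
  have hI : L (∫ t in (0:ℝ)..T, F t) = ∫ t in (0:ℝ)..T, L (F t) :=
    (L.intervalIntegral_comp_comm (hFc.intervalIntegrable _ _)).symm
  have hs : L ((1 / T) • ∫ t in (0:ℝ)..T, F t) - L A
      = (1 / T) • ∫ t in (0:ℝ)..T, (L (F t) - L A) := by
    rw [intervalIntegral.integral_sub (hLF.intervalIntegrable _ _)
      (continuous_const.intervalIntegrable _ _), intervalIntegral.integral_const, ← hI,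
      smul_sub, smul_smul, sub_zero, one_div, inv_mul_cancel₀ hT.ne', one_smul,
      L.map_smul_of_tower]
  have hb : ‖∫ t in (0:ℝ)..T, (L (F t) - L A)‖ ≤ (‖A‖ * (T * δ) * 2) * |T - 0| := by
    apply intervalIntegral.norm_integral_le_of_norm_le_const
    intro t ht
    rw [Set.uIoc_of_le hT.le] at ht
    refine (aux_point P hP A E ψ hψ t ht.1.le).trans ?_
    have := ht.2
    gcongr
  rw [← inner_conj_symm, ← inner_conj_symm (A ψ), ← map_sub, RCLike.norm_conj, ← hL, ← hL, hs,
    norm_smul, Real.norm_of_nonneg (by positivity)]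
  rw [sub_zero, abs_of_pos hT] at hb
  calc 1 / T * ‖∫ t in (0:ℝ)..T, (L (F t) - L A)‖
      ≤ 1 / T * ((‖A‖ * (T * δ) * 2) * T) := by gcongr
    _ = ‖A‖ * (T * δ) * 2 := by field_simp
    _ ≤ ‖A‖ * (T * δ) * (2 + T * δ) := by
      gcongr
      have : 0 ≤ T * δ := by positivity
      linarith
end

section
/- Let H and H' be complex inner product spaces, let u₁, …, u_N be an orthonormal family in H, let C = (c_{jk}) be an N×N complex matrix, and let ε ≥ 0 satisfy |Σ_{j=1}^N c_{jk} · conj(c_{jk'}) − δ_{kk'}| ≤ ε for all 1 ≤ k, k' ≤ N (δ the Kronecker delta). Define ψ_j = Σ_{k=1}^N conj(c_{jk}) u_k for 1 ≤ j ≤ N. Then for every continuous linear map A : H → H', |Σ_{j=1}^N ‖Aψ_j‖² − Σ_{k=1}^N ‖Au_k‖²| ≤ ε · (Σ_{k=1}^N ‖Au_k‖)². -/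
open scoped InnerProductSpace ComplexConjugate BigOperators

/-- Quantitative finite-dimensional core of Lemma 2.2, equation (2.1): if the
change-of-basis matrix `c` is almost unitary with defect `ε`, then the sums of
`‖Aψ_j‖²` over the quasimodes `ψ_j = Σ_k conj(c_{jk}) u_k` agree with the sums of
`‖Au_k‖²` over the orthonormal family `u_k`, up to `ε (Σ_k ‖Au_k‖)²`. -/
theorem sum_norm_sq_quasimode_sub_sum_norm_sq_le
    {H H' : Type*} [NormedAddCommGroup H] [InnerProductSpace ℂ H]
    [NormedAddCommGroup H'] [InnerProductSpace ℂ H']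
    (N : ℕ) (u : Fin N → H) (hu : Orthonormal ℂ u)
    (c : Fin N → Fin N → ℂ) (ε : ℝ) (hε : 0 ≤ ε)
    (halmost : ∀ k k' : Fin N,
      ‖((∑ j, c j k * conj (c j k')) - if k = k' then 1 else 0 : ℂ)‖ ≤ ε)
    (ψ : Fin N → H) (hψ : ∀ j, ψ j = ∑ k, conj (c j k) • u k)
    (A : H →L[ℂ] H') :
    |(∑ j, ‖A (ψ j)‖ ^ 2) - ∑ k, ‖A (u k)‖ ^ 2| ≤ ε * (∑ k, ‖A (u k)‖) ^ 2 := by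
  have key : (((∑ j, ‖A (ψ j)‖ ^ 2) - ∑ k, ‖A (u k)‖ ^ 2 : ℝ) : ℂ)
      = ∑ k, ∑ k', ((∑ j, c j k * conj (c j k')) - if k = k' then 1 else 0 : ℂ)
          * ⟪A (u k), A (u k')⟫_ℂ := by
    have h1 : ∀ j, ((‖A (ψ j)‖ : ℂ)) ^ 2
        = ∑ k, ∑ k', c j k * conj (c j k') * ⟪A (u k), A (u k')⟫_ℂ := by
      intro j
      have h := inner_self_eq_norm_sq_to_K (𝕜 := ℂ) (A (ψ j))
      refine h.symm.trans ?_
      rw [hψ j, map_sum, sum_inner]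
      refine Finset.sum_congr rfl fun k _ => ?_
      rw [inner_sum]
      refine Finset.sum_congr rfl fun k' _ => ?_
      rw [map_smul, map_smul, inner_smul_left, inner_smul_right, Complex.conj_conj]
      ring
    have h2 : ∀ k, ((‖A (u k)‖ : ℂ)) ^ 2 = ⟪A (u k), A (u k)⟫_ℂ := fun k =>
      (inner_self_eq_norm_sq_to_K (𝕜 := ℂ) (A (u k))).symm
    push_cast
    simp only [h1, h2, sub_mul, Finset.sum_sub_distrib, Finset.sum_mul, ite_mul, one_mul,
      zero_mul, Finset.sum_ite_eq, Finset.mem_univ, if_true]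
    congr 1
    rw [Finset.sum_comm]
    refine Finset.sum_congr rfl fun k _ => ?_
    rw [Finset.sum_comm]
  rw [← Real.norm_eq_abs, ← Complex.norm_real, key, sq, Finset.sum_mul_sum, Finset.mul_sum]
  refine (norm_sum_le _ _).trans (Finset.sum_le_sum fun k _ => ?_)
  rw [Finset.mul_sum]
  refine (norm_sum_le _ _).trans (Finset.sum_le_sum fun k' _ => ?_)
  rw [norm_mul]
  exact mul_le_mul (halmost k k') (norm_inner_le_norm _ _) (norm_nonneg _) hε
end

section
/- Let H be a complex inner product space, let u₁, …, u_N be an orthonormal family in H, let C = (c_{jk}) be an N×N complex matrix, and let ε ≥ 0 satisfy |Σ_{j=1}^N c_{jk} · conj(c_{jk'}) − δ_{kk'}| ≤ ε for all 1 ≤ k, k' ≤ N (δ the Kronecker delta). Define ψ_j = Σ_{k=1}^N conj(c_{jk}) u_k for 1 ≤ j ≤ N. Then for every continuous linear operator A : H → H with operator norm ‖A‖, |Σ_{j=1}^N ⟨Aψ_j, ψ_j⟩ − Σ_{k=1}^N ⟨Au_k, u_k⟩| ≤ ε · N² · ‖A‖. -/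
open scoped InnerProductSpace ComplexConjugate BigOperators

/-- Quantitative finite-dimensional core of Lemma 2.2, equation (2.2): sums of the
diagonal matrix elements `⟨Aψ_j, ψ_j⟩` over the quasimodes `ψ_j = Σ_k conj(c_{jk}) u_k`
agree with the trace `Σ_k ⟨Au_k, u_k⟩` over the orthonormal family `u_k`, up to
`ε N² ‖A‖`, where `ε` is the almost-unitarity defect of the matrix `c`. -/
theorem abs_sum_inner_quasimode_sub_sum_inner_le
    {H : Type*} [NormedAddCommGroup H] [InnerProductSpace ℂ H]
    (N : ℕ) (u : Fin N → H) (hu : Orthonormal ℂ u)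
    (c : Fin N → Fin N → ℂ) (ε : ℝ) (hε : 0 ≤ ε)
    (halmost : ∀ k k' : Fin N,
      ‖((∑ j, c j k * conj (c j k')) - if k = k' then 1 else 0 : ℂ)‖ ≤ ε)
    (ψ : Fin N → H) (hψ : ∀ j, ψ j = ∑ k, conj (c j k) • u k)
    (A : H →L[ℂ] H) :
    ‖((∑ j, ⟪A (ψ j), ψ j⟫_ℂ) - ∑ k, ⟪A (u k), u k⟫_ℂ : ℂ)‖
      ≤ ε * (N : ℝ) ^ 2 * ‖A‖ := by
  have h1 : ((∑ j, ⟪A (ψ j), ψ j⟫_ℂ) - ∑ k, ⟪A (u k), u k⟫_ℂ : ℂ)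
      = ∑ k, ∑ k', ((∑ j, c j k * conj (c j k')) - if k = k' then 1 else 0 : ℂ)
          * ⟪A (u k), u k'⟫_ℂ := by
    have h2 : ∀ j, ⟪A (ψ j), ψ j⟫_ℂ
        = ∑ k, ∑ k', c j k * conj (c j k') * ⟪A (u k), u k'⟫_ℂ := by
      intro j
      rw [hψ j, map_sum, sum_inner]
      refine Finset.sum_congr rfl fun k _ => ?_
      rw [inner_sum]
      refine Finset.sum_congr rfl fun k' _ => ?_
      rw [map_smul, inner_smul_left, inner_smul_right, Complex.conj_conj]
      ring
    simp only [h2, sub_mul, Finset.sum_sub_distrib, Finset.sum_mul]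
    congr 1
    · rw [Finset.sum_comm]
      refine Finset.sum_congr rfl fun k _ => ?_
      rw [Finset.sum_comm]
    · simp
  rw [h1]
  have h3 : ∀ k k', ‖((∑ j, c j k * conj (c j k')) - if k = k' then 1 else 0 : ℂ)
          * ⟪A (u k), u k'⟫_ℂ‖ ≤ ε * ‖A‖ := by
    intro k k'
    rw [norm_mul]
    refine mul_le_mul (halmost k k') ?_ (norm_nonneg _) hε
    refine (norm_inner_le_norm _ _).trans ?_
    have h4 := A.le_opNorm (u k)
    rw [hu.1 k, mul_one] at h4
    rw [hu.1 k', mul_one]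
    exact h4
  calc _ ≤ ∑ _k : Fin N, ∑ _k' : Fin N, ε * ‖A‖ :=
        norm_sum_le_of_le _ fun k _ => norm_sum_le_of_le _ fun k' _ => h3 k k'
    _ = ε * (N : ℝ) ^ 2 * ‖A‖ := by
        simp
        ring
end
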